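/- Let U and V be strings with |V| ≤ 2·|U|. If U occurs in V at three or more positions, then the set of all positions at which U occurs in V forms an arithmetic progression whose common difference equals the minimal period of U. -/

import Mathlib

/-- `U` occurs in `T` at position `q` (0-indexed): the substring of `T` of length
`|U|` starting at position `q` equals `U`. -/
def occursAt {α : Type*} (U T : List α) (q : ℕ) : Prop :=
  (T.drop q).take U.length = U

/-- `q` is a period of the string `x`. -/
def IsPeriod {α : Type*} (x : List α) (q : ℕ) : Prop :=
  0 < q ∧ q ≤ x.length ∧ ∀ i, i + q < x.length → x[i]? = x[i + q]?

/-- The minimal period of `x`. -/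
noncomputable def minPeriod {α : Type*} (x : List α) : ℕ :=
  sInf {q | IsPeriod x q}

theorem occursAt_iff_getElem? {α : Type*} {U V : List α} {q : ℕ} :
    occursAt U V q ↔ ∀ i < U.length, V[q + i]? = U[i]? := by
  unfold occursAt
  constructor
  · intro h i hi
    rw [← List.getElem?_drop, ← List.getElem?_take_of_lt hi, h]
  · intro h
    apply List.ext_getElem?
    intro i
    by_cases hi : i < U.length
    · rw [List.getElem?_take_of_lt hi, List.getElem?_drop, h i hi]
    · rw [List.getElem?_eq_none (by simp; omega), List.getElem?_eq_none (by omega)]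

theorem occursAt.add_length_le {α : Type*} {U V : List α} {q : ℕ} (h : occursAt U V q)
    (hU : 0 < U.length) : q + U.length ≤ V.length := by
  have := congrArg List.length h
  simp only [List.length_take, List.length_drop] at this
  omega

theorem IsPeriod.getElem?_add_mul {α : Type*} {x : List α} {p : ℕ} (h : IsPeriod x p)
    (k i : ℕ) (hi : i + k * p < x.length) : x[i]? = x[i + k * p]? := by
  induction k with
  | zero => simp
  | succ k ih =>
    rw [Nat.succ_mul, ← add_assoc] at hi ⊢
    rw [ih (by omega), h.2.2 _ hi]

theorem IsPeriod.sub {α : Type*} {x : List α} {p q : ℕ} (hp : IsPeriod x p)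
    (hq : IsPeriod x q) (hpq : p < q) (hle : p + q ≤ x.length) : IsPeriod x (q - p) := by
  refine ⟨by omega, by omega, fun i hi => ?_⟩
  by_cases h : p ≤ i
  · have h1 := hp.2.2 (i - p) (by omega)
    have h2 := hq.2.2 (i - p) (by omega)
    rw [show i - p + p = i by omega] at h1
    rw [show i - p + q = i + (q - p) by omega] at h2
    rw [← h1, h2]
  · have h1 := hq.2.2 i (by omega)
    have h2 := hp.2.2 (i + (q - p)) (by omega)
    rw [show i + (q - p) + p = i + q by omega] at h2
    rw [h1, h2]

theorem IsPeriod.isPeriod_minPeriod {α : Type*} {x : List α} {q : ℕ} (hq : IsPeriod x q) :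
    IsPeriod x (minPeriod x) :=
  Nat.sInf_mem (s := {q | IsPeriod x q}) ⟨q, hq⟩

theorem IsPeriod.minPeriod_le {α : Type*} {x : List α} {q : ℕ} (hq : IsPeriod x q) :
    minPeriod x ≤ q :=
  Nat.sInf_le (s := {q | IsPeriod x q}) hq

/-- A weak form of the Fine–Wilf theorem. -/
theorem IsPeriod.minPeriod_dvd {α : Type*} {x : List α} {q : ℕ} (hq : IsPeriod x q)
    (hle : minPeriod x + q ≤ x.length) : minPeriod x ∣ q := by
  induction q using Nat.strong_induction_on with
  | _ q ih =>
    have hP := hq.isPeriod_minPeriod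
    obtain h | h := hq.minPeriod_le.eq_or_lt
    · exact dvd_of_eq h
    · have hpos := hP.1
      have hd := ih (q - minPeriod x) (by omega) (hP.sub hq h hle) (by omega)
      exact (Nat.dvd_sub_iff_left h.le dvd_rfl).mp hd

theorem occursAt.isPeriod_sub {α : Type*} {U V : List α} {p q : ℕ} (hp : occursAt U V p)
    (hq : occursAt U V q) (hpq : p < q) (hle : q - p ≤ U.length) : IsPeriod U (q - p) := by
  rw [occursAt_iff_getElem?] at hp hq
  refine ⟨by omega, hle, fun i hi => ?_⟩
  rw [← hq i (by omega), ← hp _ hi]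
  congr 1
  omega

/-- If two occurrences of `U` overlap or touch and their distance is a multiple of a period `p`
of `U`, then `U` also occurs at every position between them that is congruent to them
modulo `p`. -/
theorem occursAt.of_between {α : Type*} {U V : List α} {a p j k : ℕ} (hp : IsPeriod U p)
    (ha : occursAt U V a) (hb : occursAt U V (a + (j + k) * p))
    (hle : (j + k) * p ≤ U.length) : occursAt U V (a + j * p) := by
  rw [occursAt_iff_getElem?] at *
  intro i hi
  rw [add_mul] at hb hle
  by_cases h : i + j * p < U.length
  · rw [hp.getElem?_add_mul j i h, ← ha _ h]
    congr 1
    omega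
  · have h1 := hp.getElem?_add_mul k (i - k * p) (by omega)
    rw [show i - k * p + k * p = i by omega] at h1
    rw [← h1, ← hb _ (by omega)]
    congr 1
    omega

theorem occurrences_form_arithmetic_progression {α : Type*} (U V : List α)
    (hlen : V.length ≤ 2 * U.length)
    (hcard : 3 ≤ {q | occursAt U V q}.ncard) :
    ∃ a t : ℕ, {q | occursAt U V q} = (fun j => a + j * minPeriod U) '' Set.Iio t := by
  have hU : 0 < U.length := by
    by_contra h0
    have hnil : U = [] := List.length_eq_zero_iff.mp (by omega)
    have huniv : {q | occursAt U V q} = Set.univ := by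
      ext q
      simp [occursAt, hnil]
    rw [huniv, Set.ncard_univ, Nat.card_eq_zero_of_infinite] at hcard
    omega
  set S := {q | occursAt U V q}
  have hfin : S.Finite := Set.finite_of_ncard_pos (by omega)
  have hne : S.Nonempty := Set.nonempty_of_ncard_ne_zero (by omega)
  obtain ⟨a, ha, hmin⟩ := hfin.exists_minimalFor id S hne
  obtain ⟨b, hb, hmax⟩ := hfin.exists_maximalFor id S hne
  have hmin' : ∀ q ∈ S, a ≤ q := fun q hq => by
    by_contra h
    exact h (hmin hq (by simp only [id]; omega))
  have hmax' : ∀ q ∈ S, q ≤ b := fun q hq => by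
    by_contra h
    exact h (hmax hq (by simp only [id]; omega))
  have hbU : b ≤ U.length := by
    have := occursAt.add_length_le hb hU
    omega
  obtain ⟨c, hc, hcab⟩ : ∃ c ∈ S, c ∉ ({a, b} : Set ℕ) := by
    refine Set.exists_mem_notMem_of_ncard_lt_ncard ?_
    have := Set.ncard_insert_le a {b}
    rw [Set.ncard_singleton] at this
    omega
  have key : ∀ q ∈ S, q ≠ a → q ≠ b →
      minPeriod U ∣ q - a ∧ minPeriod U ∣ b - q ∧ a < q ∧ q < b := by
    intro q hq hqa hqb
    have h1 := hmin' q hq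
    have h2 := hmax' q hq
    have hx := occursAt.isPeriod_sub ha hq (by omega) (by omega)
    have hy := occursAt.isPeriod_sub hq hb (by omega) (by omega)
    have hxm := hx.minPeriod_le
    have hym := hy.minPeriod_le
    exact ⟨hx.minPeriod_dvd (by omega), hy.minPeriod_dvd (by omega), by omega, by omega⟩
  simp only [Set.mem_insert_iff, Set.mem_singleton_iff, not_or] at hcab
  obtain ⟨hca, hbc, hac, hcb⟩ := key c hc hcab.1 hcab.2
  have hP : IsPeriod U (minPeriod U) :=
    (occursAt.isPeriod_sub ha hc hac (by omega)).isPeriod_minPeriod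
  have hba : minPeriod U ∣ b - a := by
    have := dvd_add hca hbc
    rwa [show c - a + (b - c) = b - a by omega] at this
  obtain ⟨m, hm⟩ := hba
  rw [mul_comm] at hm
  refine ⟨a, m + 1, Set.Subset.antisymm ?_ ?_⟩
  · intro q hq
    have h1 := hmin' q hq
    have h2 := hmax' q hq
    have hd : minPeriod U ∣ q - a := by
      by_cases hqa : q = a
      · simp [hqa]
      by_cases hqb : q = b
      · exact ⟨m, by rw [hqb, hm, mul_comm]⟩
      exact (key q hq hqa hqb).1
    obtain ⟨j, hj⟩ := hd
    rw [mul_comm] at hj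
    refine ⟨j, ?_, by simp only; omega⟩
    have : j ≤ m := Nat.le_of_mul_le_mul_right (by omega : j * minPeriod U ≤ m * minPeriod U) hP.1
    exact Nat.lt_succ_of_le this
  · rintro _ ⟨j, hj, rfl⟩
    obtain ⟨k, rfl⟩ := Nat.exists_eq_add_of_le (Nat.le_of_lt_succ hj)
    refine occursAt.of_between hP ha (k := k) ?_ (by omega)
    rw [← hm, show a + (b - a) = b by omega]
    exact hb
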